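/- Let ℓ ≥ 2, m ≥ 1, k ≥ 0 be integers. For all 1 ≤ i < j ≤ ℓ and every integer p with −m ≤ p ≤ m, the polynomial Σ_{x_i}^{x_j} t^k g(t)^{\underline{m}} Δt ∈ ℂ[x_1,…,x_ℓ] is divisible by (x_i − x_j − p). -/

import Mathlib

open MvPolynomial Polynomial

noncomputable section

abbrev S (ℓ : ℕ) := MvPolynomial (Fin ℓ) ℂ

def gpoly (ℓ : ℕ) : Polynomial (S ℓ) :=
  ∏ p : Fin ℓ, (Polynomial.X - Polynomial.C (MvPolynomial.X p))

/-- Falling power f(t)^{\underline{m}} = f(t) f(t-1) ⋯ f(t-m+1). -/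
def fpow {A : Type*} [CommRing A] (f : Polynomial A) (m : ℕ) : Polynomial A :=
  ∏ i ∈ Finset.range m, f.comp (Polynomial.X - (i : Polynomial A))

theorem eval_gpoly_X (ℓ : ℕ) (i : Fin ℓ) : (gpoly ℓ).eval (MvPolynomial.X i) = 0 := by
  rw [gpoly, Polynomial.eval_prod]
  exact Finset.prod_eq_zero (Finset.mem_univ i) (by simp)

theorem eval_fpow_add_natCast {A : Type*} [CommRing A] {f : Polynomial A} {a : A}
    (hf : f.eval a = 0) {m n : ℕ} (hn : n < m) : (fpow f m).eval (a + n) = 0 := by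
  rw [fpow, Polynomial.eval_prod]
  exact Finset.prod_eq_zero (Finset.mem_range.2 hn) (by simp [Polynomial.eval_comp, hf])

/-- An antidifference of `h * fpow f m` takes the same value at a root `a` of `f` and at
`a + 1, …, a + m`. -/
theorem eval_antidifference_add_natCast {A : Type*} [CommRing A] {F f h : Polynomial A} {a : A}
    {m : ℕ} (hF : F.comp (Polynomial.X + 1) - F = h * fpow f m) (hf : f.eval a = 0) {n : ℕ}
    (hn : n ≤ m) : F.eval (a + n) = F.eval a := by
  induction n with
  | zero => simp
  | succ n ih =>
    have step := congrArg (Polynomial.eval (a + n)) hF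
    rw [Polynomial.eval_mul, eval_fpow_add_natCast hf hn, mul_zero, Polynomial.eval_sub,
      sub_eq_zero, Polynomial.eval_comp, ih (Nat.le_of_succ_le hn)] at step
    simpa [add_assoc] using step

theorem stmt9 (ℓ : ℕ) (hℓ : 2 ≤ ℓ) (m k : ℕ) (hm : 1 ≤ m)
    -- F is an indefinite summation (antidifference) of t^k g(t)^{\underline{m}}
    (F : Polynomial (S ℓ))
    (hF : F.comp (Polynomial.X + 1) - F = Polynomial.X ^ k * fpow (gpoly ℓ) m) :
    ∀ i j : Fin ℓ, i < j → ∀ p : ℤ, -(m : ℤ) ≤ p → p ≤ m →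
      (MvPolynomial.X i - MvPolynomial.X j - (p : S ℓ)) ∣
        (F.eval (MvPolynomial.X j) - F.eval (MvPolynomial.X i)) := by
  intro i j _ p hp₁ hp₂
  obtain ⟨n, rfl | rfl⟩ := p.eq_nat_or_neg
  · rw [← eval_antidifference_add_natCast hF (eval_gpoly_X ℓ j) (n := n) (by omega),
      dvd_sub_comm]
    convert Polynomial.sub_dvd_eval_sub (MvPolynomial.X i) (MvPolynomial.X j + (n : S ℓ)) F using 1
    push_cast
    ring
  · rw [← eval_antidifference_add_natCast hF (eval_gpoly_X ℓ i) (n := n) (by omega),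
      dvd_sub_comm]
    convert Polynomial.sub_dvd_eval_sub (MvPolynomial.X i + (n : S ℓ)) (MvPolynomial.X j) F using 1
    push_cast
    ring

end
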